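/- Under the same setting (finite sets Y⁽ⁿ⁾ ⊆ ℝ^d, φ* ∈ Δ^{d−1} with unique maximizers a⁽ⁿ⁾), there exists γ > 0 such that for every φ ∈ Δ^{d−1} with g(φ) ≠ 0 one has φ*ᵀ g(φ) ≤ −γ, i.e. the SPO/estimated loss ℓ_est(φ) = −φ*ᵀ g(φ) is bounded below by a positive constant whenever g(φ) ≠ 0. -/

import Mathlib

open scoped RealInnerProductSpace

/-- A function that is negative on a finite set is bounded away from zero there. -/
theorem Finset.exists_pos_forall_le_neg {α : Type*} (S : Finset α) (f : α → ℝ)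
    (hf : ∀ s ∈ S, f s < 0) : ∃ γ > (0 : ℝ), ∀ s ∈ S, f s ≤ -γ := by
  rcases S.eq_empty_or_nonempty with rfl | hS
  · exact ⟨1, one_pos, by simp⟩
  · obtain ⟨m, hm, hmax⟩ := S.exists_max_image f hS
    exact ⟨-f m, neg_pos.mpr (hf m hm), fun s hs => by simpa using hmax s hs⟩

/-- A choice of feasible points with nonzero mean deviation from the unique maximizers
has strictly negative mean regret. -/
theorem inner_mean_sub_neg {E : Type*} [NormedAddCommGroup E] [InnerProductSpace ℝ E] {N : ℕ}
    (Y : Fin N → Finset E) (v : E) (a s : Fin N → E) (hs : ∀ n, s n ∈ Y n)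
    (huniq : ∀ n, ∀ y ∈ Y n, y ≠ a n → ⟪v, y⟫ < ⟪v, a n⟫)
    (hne : (N : ℝ)⁻¹ • ∑ n, (s n - a n) ≠ 0) :
    ⟪v, (N : ℝ)⁻¹ • ∑ n, (s n - a n)⟫ < 0 := by
  obtain ⟨hN, hsum⟩ := smul_ne_zero_iff.mp hne
  obtain ⟨k, -, hk⟩ := Finset.exists_ne_zero_of_sum_ne_zero hsum
  have hNpos : 0 < (N : ℝ)⁻¹ := lt_of_le_of_ne (by positivity) hN.symm
  rw [real_inner_smul_right, inner_sum]
  refine mul_neg_of_pos_of_neg hNpos (Finset.sum_neg' (fun n _ => ?_) ⟨k, Finset.mem_univ k, ?_⟩)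
  · rw [inner_sub_right, sub_nonpos]
    by_cases h : s n = a n
    · rw [h]
    · exact (huniq n _ (hs n) h).le
  · rw [inner_sub_right, sub_neg]
    exact huniq k _ (hs k) (sub_ne_zero.mp hk)

/-- SPO-loss lower bound: there is γ > 0 with φ*ᵀg(φ) ≤ −γ whenever g(φ) ≠ 0. -/
theorem stmt_7 {d N : ℕ} (hN : 0 < N)
    (Y : Fin N → Finset (EuclideanSpace ℝ (Fin d)))
    (hY : ∀ n, (Y n).Nonempty)
    (Δ : Set (EuclideanSpace ℝ (Fin d)))
    (hΔ : Δ = {φ | (∀ i, 0 ≤ φ i) ∧ ∑ i, φ i = 1})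
    (φs : EuclideanSpace ℝ (Fin d)) (hφs : φs ∈ Δ)
    (a : Fin N → EuclideanSpace ℝ (Fin d)) (ha : ∀ n, a n ∈ Y n)
    (huniq : ∀ n, ∀ y ∈ Y n, y ≠ a n → ⟪φs, y⟫ < ⟪φs, a n⟫)
    (sel : EuclideanSpace ℝ (Fin d) → Fin N → EuclideanSpace ℝ (Fin d))
    (hsel : ∀ φ n, sel φ n ∈ Y n ∧ ∀ y ∈ Y n, ⟪φ, y⟫ ≤ ⟪φ, sel φ n⟫) :
    ∃ γ > (0 : ℝ), ∀ φ ∈ Δ, (N : ℝ)⁻¹ • ∑ n, (sel φ n - a n) ≠ 0 →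
      ⟪φs, (N : ℝ)⁻¹ • ∑ n, (sel φ n - a n)⟫ ≤ -γ := by
  classical
  obtain ⟨γ, hγ, hle⟩ := Finset.exists_pos_forall_le_neg
    ((Fintype.piFinset Y).filter fun s => (N : ℝ)⁻¹ • ∑ n, (s n - a n) ≠ 0)
    (fun s => ⟪φs, (N : ℝ)⁻¹ • ∑ n, (s n - a n)⟫) (fun s hs => by
      obtain ⟨hsY, hne⟩ := Finset.mem_filter.mp hs
      exact inner_mean_sub_neg Y φs a s (Fintype.mem_piFinset.mp hsY) huniq hne)
  exact ⟨γ, hγ, fun φ _ hne => hle (sel φ) (Finset.mem_filter.mpr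
    ⟨Fintype.mem_piFinset.mpr fun n => (hsel φ n).1, hne⟩)⟩
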